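/- Let n₁,n₂ ≥ 2, 1 ≤ s₁ ≤ n₁, 1 ≤ s₂ ≤ n₂, and suppose m ≥ 2(n₁+n₂)−4 if s₁ = n₁ and s₂ = n₂, and m ≥ 2(s₁+s₂)−2 otherwise. Then the set of pairs (Y,Z) ∈ M(m,n₁) × M(m,n₂) such that the linear map M_{Y,Z} : M(n₁,n₂) → ℂ^m, M_{Y,Z}(X) = (tr(Z₁ᵗY₁X),…,tr(Z_mᵗY_mX)) (Y_i, Z_i the i-th rows of Y and Z), is NOT stably (s₁,s₂)-injective has dimension strictly smaller than the dimension m(n₁+n₂) of M(m,n₁) × M(m,n₂); in particular it has Lebesgue measure zero. -/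

import Mathlib

noncomputable section

/-- A vector in `ℂⁿ` is `s`-sparse if it has at most `s` nonzero entries. -/
def Sparse {n : ℕ} (s : ℕ) (u : Fin n → ℂ) : Prop := {i | u i ≠ 0}.ncard ≤ s

/-- `M¹_{s₁,s₂}(n₁,n₂)`: matrices of the form `u vᵗ` with `u` `s₁`-sparse and `v` `s₂`-sparse. -/
def M1 (n₁ n₂ s₁ s₂ : ℕ) : Set (Matrix (Fin n₁) (Fin n₂) ℂ) :=
  {X | ∃ u : Fin n₁ → ℂ, ∃ v : Fin n₂ → ℂ,
    Sparse s₁ u ∧ Sparse s₂ v ∧ X = Matrix.vecMulVec u v}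

/-- `Δ(S) = {X - Y : X, Y ∈ S}`. -/
def diffSet {n₁ n₂ : ℕ} (S : Set (Matrix (Fin n₁) (Fin n₂) ℂ)) :
    Set (Matrix (Fin n₁) (Fin n₂) ℂ) :=
  {Z | ∃ X ∈ S, ∃ Y ∈ S, Z = X - Y}

/-- Frobenius norm of a complex matrix. -/
def frob {a b : ℕ} (X : Matrix (Fin a) (Fin b) ℂ) : ℝ :=
  Real.sqrt (∑ i, ∑ j, ‖X i j‖ ^ 2)

/-- Euclidean norm of a vector in `ℂ^m`. -/
def l2 {m : ℕ} (v : Fin m → ℂ) : ℝ := Real.sqrt (∑ i, ‖v i‖ ^ 2)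

/-- A (linear) map `M : M(n₁,n₂) → ℂ^m` is stably `(s₁,s₂)`-injective if there is `C > 0` with
`‖M(X)‖₂ ≥ C ‖X‖_F` for all `X ∈ Δ(M¹_{s₁,s₂}(n₁,n₂))`. -/
def StablyInj (n₁ n₂ s₁ s₂ m : ℕ) (M : Matrix (Fin n₁) (Fin n₂) ℂ → (Fin m → ℂ)) : Prop :=
  ∃ C : ℝ, 0 < C ∧ ∀ X ∈ diffSet (M1 n₁ n₂ s₁ s₂), C * frob X ≤ l2 (M X)

open MeasureTheory

/-- For `Y ∈ M(m,n₁)`, `Z ∈ M(m,n₂)` (given by their rows), the linear map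
`M_{Y,Z}(X) = (tr(Z₁ᵗY₁X),…,tr(Z_mᵗY_mX))`. -/
def MYZ {n₁ n₂ m : ℕ} (Y : Fin m → Fin n₁ → ℂ) (Z : Fin m → Fin n₂ → ℂ)
    (X : Matrix (Fin n₁) (Fin n₂) ℂ) : Fin m → ℂ :=
  fun i => Matrix.trace (Matrix.vecMulVec (Z i) (Y i) * X)

/-- The Zariski topology on `M(m,n₁) × M(m,n₂) ≅ ℂ^{m(n₁+n₂)}`: closed sets are common zero
loci of families of complex polynomials in the entries of the two matrices. -/
def zarProd (m n₁ n₂ : ℕ) :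
    TopologicalSpace ((Fin m → Fin n₁ → ℂ) × (Fin m → Fin n₂ → ℂ)) :=
  TopologicalSpace.generateFrom
    {U | ∃ p : MvPolynomial ((Fin m × Fin n₁) ⊕ (Fin m × Fin n₂)) ℂ,
      U = {YZ | MvPolynomial.eval
        (Sum.elim (fun q => YZ.1 q.1 q.2) (fun q => YZ.2 q.1 q.2)) p ≠ 0}}


/-- Krull dimension of a subset of a hypersurface. -/
theorem krull_aux {E τ : Type} [Fintype τ] [T : TopologicalSpace E] (co : E → τ → ℂ)
    (hT : T = TopologicalSpace.generateFrom
      {U | ∃ p : MvPolynomial τ ℂ, U = {x | MvPolynomial.eval (co x) p ≠ 0}})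
    (B : Set E) (p : MvPolynomial τ ℂ) (hp : p ≠ 0)
    (hB : ∀ x ∈ B, MvPolynomial.eval (co x) p = 0) :
    topologicalKrullDim B < ((Fintype.card τ : ℕ) : WithBot ℕ∞) := by
  have hbasis := TopologicalSpace.isTopologicalBasis_of_subbasis_of_inter hT (by
    rintro _ ⟨p, rfl⟩ _ ⟨q, rfl⟩
    exact ⟨p * q, by ext x; simp⟩)
  have hopen : ∀ q : MvPolynomial τ ℂ, IsOpen {x : B | MvPolynomial.eval (co x) q ≠ 0} := fun q =>
    (hbasis.isOpen (Or.inr ⟨q, rfl⟩)).preimage continuous_subtype_val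
  let I : TopologicalSpace.IrreducibleCloseds B → Ideal (MvPolynomial τ ℂ) := fun Z =>
    { carrier := {q | ∀ x ∈ Z, MvPolynomial.eval (co x) q = 0}
      add_mem' := by intro a b ha hb x hx; simp [ha x hx, hb x hx]
      zero_mem' := by intro x hx; simp
      smul_mem' := by intro c a ha x hx; simp [ha x hx] }
  have hI : ∀ Z q, q ∈ I Z ↔ ∀ x ∈ Z, MvPolynomial.eval (co x) q = 0 := fun Z q => Iff.rfl
  have hprime : ∀ Z, (I Z).IsPrime := by
    intro Z
    refine ⟨?_, ?_⟩
    · intro h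
      obtain ⟨x, hx⟩ := Z.isIrreducible'.nonempty
      have := (hI Z 1).1 (by rw [h]; trivial) x hx
      simp at this
    · intro a b hab
      by_contra! hcon
      obtain ⟨h1, h2⟩ := hcon
      rw [hI] at h1 h2
      push Not at h1 h2
      obtain ⟨x, hx, hxa⟩ := h1
      obtain ⟨y, hy, hyb⟩ := h2
      obtain ⟨z, hz, hza, hzb⟩ := Z.isIrreducible'.2 _ _ (hopen a) (hopen b) ⟨x, hx, hxa⟩ ⟨y, hy, hyb⟩
      have := hab z hz
      simp only [map_mul, mul_eq_zero] at this
      rcases this with h | h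
      · exact hza h
      · exact hzb h
  have hstrict : ∀ Z W, Z < W → I W < I Z := by
    intro Z W h
    refine lt_of_le_of_ne (fun q hq x hx => hq x (h.le hx)) ?_
    intro heq
    obtain ⟨x, hxW, hxZ⟩ := Set.exists_of_ssubset (show (Z : Set B) ⊂ W from h)
    have hc : IsOpen ((Z : Set B)ᶜ) := Z.isClosed'.isOpen_compl
    obtain ⟨U, hU, hUZ⟩ := isOpen_induced_iff.1 hc
    have hxU : (x : E) ∈ U := by
      have : x ∈ (Subtype.val ⁻¹' U : Set B) := by rw [hUZ]; exact hxZ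
      exact this
    obtain ⟨V, hV, hxV, hVU⟩ := hbasis.exists_subset_of_mem_open hxU hU
    obtain ⟨q, rfl⟩ : ∃ q : MvPolynomial τ ℂ, V = {x | MvPolynomial.eval (co x) q ≠ 0} := by
      rcases hV with rfl | hV
      · exact ⟨1, by ext; simp⟩
      · exact hV
    have hxq := hxV
    have hqU := hVU
    have hqZ : q ∈ I Z := by
      intro y hy
      by_contra hne
      have : y ∈ (Subtype.val ⁻¹' U : Set B) := hqU hne
      rw [hUZ] at this
      exact this hy
    rw [← heq] at hqZ
    exact hxq (hqZ x hxW)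
  let F : TopologicalSpace.IrreducibleCloseds B → (PrimeSpectrum (MvPolynomial τ ℂ))ᵒᵈ := fun Z =>
    OrderDual.toDual ⟨I Z, hprime Z⟩
  have hF : StrictMono F := fun Z W h => hstrict Z W h
  unfold topologicalKrullDim
  rw [Order.krullDim_lt_coe_iff]
  intro l
  let l' := (l.map F hF)
  let b : (PrimeSpectrum (MvPolynomial τ ℂ))ᵒᵈ := OrderDual.toDual ⟨⊥, Ideal.isPrime_bot⟩
  have hb : l'.last < b := by
    have h1 : ∀ Z, F Z < b := by
      intro Z
      show (⊥ : Ideal (MvPolynomial τ ℂ)) < I Z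
      rw [bot_lt_iff_ne_bot]
      intro h
      have : p ∈ I Z := fun x hx => hB x x.2
      rw [h] at this
      exact hp this
    simpa [l'] using h1 _
  have hlen := Order.LTSeries.length_le_krullDim (l'.snoc b hb)
  rw [Order.krullDim_orderDual] at hlen
  have hdim : Order.krullDim (PrimeSpectrum (MvPolynomial τ ℂ)) = ((Fintype.card τ : ℕ) : WithBot ℕ∞) := by
    have := MvPolynomial.ringKrullDim_of_isNoetherianRing (R := ℂ) (ι := τ)
    rw [ringKrullDim_eq_zero_of_field] at this
    simpa [ringKrullDim] using this
  rw [hdim] at hlen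
  have : (l'.snoc b hb).length = l.length + 1 := by simp [l']
  rw [this] at hlen
  have : l.length + 1 ≤ Fintype.card τ := by exact_mod_cast hlen
  omega

open scoped Pointwise in
theorem meas_aux {E : Type*} [NormedAddCommGroup E] [NormedSpace ℝ E] [FiniteDimensional ℝ E]
    [MeasurableSpace E] [BorelSpace E] (μ : Measure E) [μ.IsAddHaarMeasure]
    (A : Set E) (hA : IsClosed A) (x₀ : E) 
    (h : ∀ v : E, {r : ℝ | x₀ + r • v ∈ A}.Finite) : μ A = 0 := by
  let A' : Set E := (fun v => x₀ + v) ⁻¹' A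
  have hA' : IsClosed A' := hA.preimage (by fun_prop)
  have e : μ A' = μ A := measure_preimage_add μ x₀ A
  rw [← e]
  have key : ∀ R : ℕ, μ (A' ∩ Metric.closedBall 0 R) = 0 := by
    intro R
    set S := A' ∩ Metric.closedBall 0 R with hS
    let r : ℕ → ℝ := fun n => 1 + 1 / ((n : ℝ) + 1)
    have hr1 : ∀ n, 1 ≤ r n := fun n => by simp only [r]; have : (0:ℝ) ≤ 1 / ((n : ℝ) + 1) := by positivity
                                           linarith
    have hr2 : ∀ n, r n ≤ 2 := fun n => by
      simp only [r]
      have : 1 / ((n : ℝ) + 1) ≤ 1 := by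
        rw [div_le_one (by positivity)]; linarith [(Nat.cast_nonneg n : (0:ℝ) ≤ n)]
      linarith
    have hr0 : ∀ n, r n ≠ 0 := fun n => by linarith [hr1 n]
    have hScl : IsClosed S := hA'.inter Metric.isClosed_closedBall
    have hm : ∀ n, MeasurableSet ((r n) • S) := fun n => by
      exact (hScl.smul_of_ne_zero (hr0 n)).measurableSet
    have ht := tendsto_measure_of_tendsto_indicator (μ := μ) (L := Filter.atTop) (A := ∅)
      (As := fun n => (r n) • S) hm (B := Metric.closedBall 0 (2 * R)) measurableSet_closedBall
      (measure_closedBall_lt_top.ne) ?_ ?_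
    · simp only [measure_empty] at ht
      refine le_antisymm (ge_of_tendsto' ht fun n => ?_) bot_le
      rw [Measure.addHaar_smul]
      refine le_mul_of_one_le_left bot_le ?_
      rw [ENNReal.one_le_ofReal, abs_of_nonneg (by have := hr1 n; positivity)]
      exact one_le_pow₀ (hr1 n)
    · filter_upwards with n
      rintro _ ⟨x, hx, rfl⟩
      have := hx.2
      simp only [Metric.mem_closedBall, dist_zero_right, norm_smul] at this ⊢
      have h3 := hr1 n
      rw [Real.norm_eq_abs, abs_of_nonneg (by linarith)]
      have := norm_nonneg x
      nlinarith [hr2 n]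
    · intro x
      have hfin : {n : ℕ | x₀ + (r n)⁻¹ • x ∈ A}.Finite := by
        refine Set.Finite.of_finite_image ((h x).subset ?_) (f := fun n => (r n)⁻¹) ?_
        · rintro _ ⟨n, hn, rfl⟩; exact hn
        · intro a _ b _ hab
          simp only [inv_inj, r, add_right_inj, one_div] at hab
          exact_mod_cast add_right_cancel hab
      have := hfin.eventually_cofinite_notMem
      rw [Nat.cofinite_eq_atTop] at this
      filter_upwards [this] with n hn
      simp only [Set.mem_empty_iff_false, iff_false]
      intro hx
      rw [Set.mem_smul_set_iff_inv_smul_mem₀ (hr0 n)] at hx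
      exact hn hx.1
  have : A' = ⋃ R : ℕ, A' ∩ Metric.closedBall 0 R := by
    ext x
    simp only [Set.mem_iUnion, Set.mem_inter_iff, exists_and_left]
    refine ⟨fun hx => ⟨hx, ?_⟩, fun hx => hx.1⟩
    obtain ⟨n, hn⟩ := exists_nat_ge ‖x‖
    exact ⟨n, by simpa using hn⟩
  rw [this]
  exact measure_iUnion_null key

theorem meas_poly {E τ : Type*} [Fintype τ] [NormedAddCommGroup E] [NormedSpace ℝ E] [FiniteDimensional ℝ E]
    [MeasurableSpace E] [BorelSpace E] (μ : Measure E) [μ.IsAddHaarMeasure]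
    (co : E →ₗ[ℝ] (τ → ℂ)) (hco : Function.Surjective co) (p : MvPolynomial τ ℂ) (hp : p ≠ 0) :
    μ {x | MvPolynomial.eval (co x) p = 0} = 0 := by
  have hx : ∃ x : E, MvPolynomial.eval (co x) p ≠ 0 := by
    by_contra! hcon
    apply hp
    apply MvPolynomial.funext
    intro y
    obtain ⟨x, rfl⟩ := hco y
    simpa using hcon x
  obtain ⟨x₀, hx₀⟩ := hx
  refine meas_aux μ _ ?_ x₀ ?_
  · have hc : Continuous co := co.continuous_of_finiteDimensional
    refine isClosed_eq ?_ continuous_const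
    exact (MvPolynomial.continuous_eval p).comp hc
  · intro v
    let q : Polynomial ℂ := MvPolynomial.aeval
      (fun e => Polynomial.C (co x₀ e) + Polynomial.X * Polynomial.C (co v e)) p
    have hq : ∀ r : ℂ, q.eval r = MvPolynomial.eval (fun e => co x₀ e + r * co v e) p := by
      intro r
      rw [← Polynomial.coe_evalRingHom]
      simp only [q]
      rw [MvPolynomial.aeval_def, MvPolynomial.hom_eval₂, MvPolynomial.eval]
      show _ = MvPolynomial.eval₂ _ _ p
      congr 1
      · ext; simp
      · ext e; simp; ring
    have hq0 : q ≠ 0 := by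
      intro h
      have := hq 0
      simp [h] at this
      exact hx₀ this.symm
    have := (q.rootSet_finite ℂ)
    refine Set.Finite.of_finite_image (this.subset ?_) (Complex.ofReal_injective.injOn)
    rintro _ ⟨r, hr, rfl⟩
    rw [Polynomial.mem_rootSet]
    refine ⟨hq0, ?_⟩
    simp only [Set.mem_ofPred_eq, map_add, map_smul] at hr
    rw [Polynomial.coe_aeval_eq_eval, hq, ← hr]
    congr 1

theorem algdep {σ τ : Type} [Fintype σ] [Fintype τ] (h : Fintype.card σ < Fintype.card τ)
    (f : τ → MvPolynomial σ ℂ) : ∃ p : MvPolynomial τ ℂ, p ≠ 0 ∧ MvPolynomial.aeval f p = 0 := by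
  by_contra! hcon
  have hai : AlgebraicIndependent ℂ f := by
    rw [algebraicIndependent_iff]
    intro p hp
    by_contra hne
    exact hcon p hne hp
  have := hai.cardinalMk_le_trdeg
  rw [MvPolynomial.trdeg_of_isDomain] at this
  simp at this
  omega

abbrev Tau (m n₁ n₂ : ℕ) := (Fin m × Fin n₁) ⊕ (Fin m × Fin n₂)

/-- The parametrisation of pairs `(Y, Z)` in terms of `X` and free parameters `w`. -/
def Gmap {m n₁ n₂ : ℕ} {R : Type} [CommRing R] (I : Finset (Fin m)) (k : Fin n₁) (l : Fin n₂)
    (X : Fin n₁ → Fin n₂ → R) (w : Tau m n₁ n₂ → R) : Tau m n₁ n₂ → R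
  | Sum.inl (i, a) =>
      if i ∈ I then
        (if a = k then - ∑ a', w (Sum.inl (i, a')) * X a' l else w (Sum.inl (i, a)) * X k l)
      else w (Sum.inl (i, a))
  | Sum.inr (i, j) =>
      if i ∈ I then w (Sum.inr (i, j))
      else
        (if j = l then - ∑ j', (∑ a, w (Sum.inl (i, a)) * X a j') * w (Sum.inr (i, j'))
          else w (Sum.inr (i, j)) * (∑ a, w (Sum.inl (i, a)) * X a l))

def exc {m n₁ n₂ : ℕ} (I : Finset (Fin m)) (k : Fin n₁) (l : Fin n₂) (i : Fin m) : Tau m n₁ n₂ :=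
  if i ∈ I then Sum.inl (i, k) else Sum.inr (i, l)

theorem exc_inj {m n₁ n₂ : ℕ} (I : Finset (Fin m)) (k : Fin n₁) (l : Fin n₂) :
    Function.Injective (exc I k l) := by
  intro i j h
  unfold exc at h
  split_ifs at h <;> simp_all

theorem Gmap_hom {m n₁ n₂ : ℕ} {R S : Type} [CommRing R] [CommRing S] (φ : R →+* S)
    (I : Finset (Fin m)) (k : Fin n₁) (l : Fin n₂)
    (X : Fin n₁ → Fin n₂ → R) (w : Tau m n₁ n₂ → R) (e : Tau m n₁ n₂) :
    φ (Gmap I k l X w e) = Gmap I k l (fun a b => φ (X a b)) (fun e => φ (w e)) e := by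
  rcases e with ⟨i, a⟩ | ⟨i, j⟩ <;> simp only [Gmap] <;> split_ifs <;> simp

theorem Gmap_scale {m n₁ n₂ : ℕ} (I : Finset (Fin m)) (k : Fin n₁) (l : Fin n₂)
    (X : Fin n₁ → Fin n₂ → ℂ) (c : ℂ) (w : Tau m n₁ n₂ → ℂ) (hw : ∀ i, w (exc I k l i) = 0) :
    ∃ w' : Tau m n₁ n₂ → ℂ, (∀ i, w' (exc I k l i) = 0) ∧
      Gmap I k l (fun a b => c * X a b) w = Gmap I k l X w' := by
  refine ⟨Sum.elim (fun q => if q.1 ∈ I then c * w (Sum.inl q) else w (Sum.inl q))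
    (fun q => if q.1 ∈ I then w (Sum.inr q) else c * w (Sum.inr q)), ?_, ?_⟩
  · intro i
    have := hw i
    unfold exc at this ⊢
    split_ifs at this ⊢ with h <;> simp [h, this]
  · funext e
    rcases e with ⟨i, a⟩ | ⟨i, j⟩ <;> simp only [Gmap] <;> split_ifs <;>
      simp [*, Finset.mul_sum, Finset.sum_mul] <;>
      grind [Finset.sum_congr, mul_comm, mul_left_comm, mul_assoc]

theorem Gmap_surj {m n₁ n₂ : ℕ} (X : Fin n₁ → Fin n₂ → ℂ) (k : Fin n₁) (l : Fin n₂)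
    (hX : X k l ≠ 0) (Y : Fin m → Fin n₁ → ℂ) (Z : Fin m → Fin n₂ → ℂ)
    (hYZ : ∀ i, ∑ j, (∑ a, Y i a * X a j) * Z i j = 0) :
    ∃ I : Finset (Fin m), ∃ w : Tau m n₁ n₂ → ℂ, (∀ i, w (exc I k l i) = 0) ∧
      Gmap I k l X w = Sum.elim (fun q => Y q.1 q.2) (fun q => Z q.1 q.2) := by
  classical
  let D : Fin m → ℂ := fun i => ∑ a, Y i a * X a l
  let I : Finset (Fin m) := Finset.univ.filter (fun i => D i = 0)
  have hI : ∀ i, i ∈ I ↔ D i = 0 := by simp [I]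
  refine ⟨I, Sum.elim (fun q => if q.1 ∈ I then (if q.2 = k then 0 else Y q.1 q.2 / X k l) else Y q.1 q.2)
    (fun q => if q.1 ∈ I then Z q.1 q.2 else (if q.2 = l then 0 else Z q.1 q.2 / D q.1)), ?_, ?_⟩
  · intro i
    unfold exc
    split_ifs with h <;> simp [h]
  · funext e
    rcases e with ⟨i, a⟩ | ⟨i, j⟩
    · by_cases hi : i ∈ I
      · have hD := (hI i).1 hi
        by_cases ha : a = k
        · subst ha
          simp only [Gmap, hi, if_true, Sum.elim_inl]
          simp only [D] at hD
          rw [← Finset.add_sum_erase _ _ (Finset.mem_univ a)] at hD ⊢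
          have h2 : ∑ x ∈ Finset.univ.erase a, (if x = a then 0 else Y i x / X a l) * X x l
            = (∑ x ∈ Finset.univ.erase a, Y i x * X x l) / X a l := by
            rw [Finset.sum_div]
            refine Finset.sum_congr rfl fun x hx => ?_
            rw [if_neg (Finset.ne_of_mem_erase hx)]
            ring
          rw [h2, eq_neg_of_add_eq_zero_right hD]
          simp
          field_simp
        · simp [Gmap, hi, ha, hX]
      · simp [Gmap, hi]
    · by_cases hi : i ∈ I
      · simp [Gmap, hi]
      · have hD : D i ≠ 0 := fun h => hi ((hI i).2 h)
        by_cases ha : j = l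
        · subst ha
          simp only [Gmap, hi, if_true, if_false, Sum.elim_inl, Sum.elim_inr]
          have h := hYZ i
          rw [← Finset.add_sum_erase _ _ (Finset.mem_univ j)] at h ⊢
          have h2 : ∑ x ∈ Finset.univ.erase j, (∑ a, Y i a * X a x) * (if x = j then 0 else Z i x / D i)
            = (∑ x ∈ Finset.univ.erase j, (∑ a, Y i a * X a x) * Z i x) / D i := by
            rw [Finset.sum_div]
            refine Finset.sum_congr rfl fun x hx => ?_
            rw [if_neg (Finset.ne_of_mem_erase hx)]
            ring
          rw [h2, eq_neg_of_add_eq_zero_right h]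
          change -(_ + -(D i * Z i j) / D i) = _
          simp
          field_simp
        · simp only [Gmap, hi, ha, if_false, Sum.elim_inl, Sum.elim_inr]
          change _ / D i * D i = _
          field_simp

/-- existence of a nonzero polynomial killing all bad pairs for the closure of `S` -/
def Good (m n₁ n₂ : ℕ) (S : Set (Fin n₁ → Fin n₂ → ℂ)) : Prop :=
  ∃ p : MvPolynomial (Tau m n₁ n₂) ℂ, p ≠ 0 ∧ ∀ X ∈ closure S, X ≠ 0 →
    ∀ (Y : Fin m → Fin n₁ → ℂ) (Z : Fin m → Fin n₂ → ℂ),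
      (∀ i, ∑ j, (∑ a, Y i a * X a j) * Z i j = 0) →
      MvPolynomial.eval (Sum.elim (fun q => Y q.1 q.2) (fun q => Z q.1 q.2)) p = 0

theorem Good.mono {m n₁ n₂ : ℕ} {S T : Set (Fin n₁ → Fin n₂ → ℂ)} (hT : Good m n₁ n₂ T) (h : S ⊆ T) :
    Good m n₁ n₂ S := by
  obtain ⟨p, hp, h1⟩ := hT
  exact ⟨p, hp, fun X hX => h1 X (closure_mono h hX)⟩

theorem Good.iUnion {m n₁ n₂ : ℕ} {ι : Type} [Finite ι] {S : ι → Set (Fin n₁ → Fin n₂ → ℂ)}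
    (hS : ∀ i, Good m n₁ n₂ (S i)) : Good m n₁ n₂ (⋃ i, S i) := by
  have := Fintype.ofFinite ι
  choose p hp h using hS
  refine ⟨∏ i, p i, Finset.prod_ne_zero_iff.2 fun i _ => hp i, ?_⟩
  intro X hX hX0 Y Z hYZ
  rw [closure_iUnion_of_finite] at hX
  obtain ⟨i, hi⟩ := Set.mem_iUnion.1 hX
  rw [map_prod]
  exact Finset.prod_eq_zero (Finset.mem_univ i) (h i X hi hX0 Y Z hYZ)

theorem Good.zero (m n₁ n₂ : ℕ) : Good m n₁ n₂ {0} :=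
  ⟨1, one_ne_zero, fun X hX h => by rw [closure_singleton] at hX; exact absurd hX h⟩

theorem Good.param {m n₁ n₂ : ℕ} {σ : Type} [Fintype σ] (hσ : Fintype.card σ < m)
    (x : Fin n₁ → Fin n₂ → MvPolynomial σ ℂ) (S : Set (Fin n₁ → Fin n₂ → ℂ))
    (hS : ∀ X ∈ S, ∃ (c : ℂ) (t : σ → ℂ), ∀ a b, X a b = c * MvPolynomial.eval t (x a b)) :
    Good m n₁ n₂ S := by
  classical
  have key : ∀ (q : Finset (Fin m) × Fin n₁ × Fin n₂), ∃ p : MvPolynomial (Tau m n₁ n₂) ℂ, p ≠ 0 ∧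
      ∀ X ∈ closure S, ∀ w : Tau m n₁ n₂ → ℂ, (∀ i, w (exc q.1 q.2.1 q.2.2 i) = 0) →
        MvPolynomial.eval (Gmap q.1 q.2.1 q.2.2 X w) p = 0 := by
    rintro ⟨I, k, l⟩
    dsimp only
    let ρ := {e : Tau m n₁ n₂ // e ∉ Finset.univ.image (exc I k l)}
    have hcard : Fintype.card (σ ⊕ ρ) < Fintype.card (Tau m n₁ n₂) := by
      have h1 : Fintype.card ρ + m = Fintype.card (Tau m n₁ n₂) := by
        have : Fintype.card ρ = _ := Fintype.card_subtype_compl (fun e : Tau m n₁ n₂ => e ∈ Finset.univ.image (exc I k l))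
        rw [this, Fintype.card_coe, Finset.card_image_of_injective _ (exc_inj I k l)]
        have : (Finset.univ : Finset (Fin m)).card ≤ _ := Finset.card_le_card_of_injOn (t := Finset.univ) (exc I k l) (by simp) ((exc_inj I k l).injOn)
        simp only [Finset.card_univ, Fintype.card_fin] at this ⊢
        omega
      rw [Fintype.card_sum]; omega
    let W : Tau m n₁ n₂ → MvPolynomial (σ ⊕ ρ) ℂ := fun e =>
      if h : e ∉ Finset.univ.image (exc I k l) then MvPolynomial.X (Sum.inr ⟨e, h⟩) else 0
    obtain ⟨p, hp, hpe⟩ := algdep hcard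
      (Gmap I k l (fun a b => MvPolynomial.rename Sum.inl (x a b)) W)
    refine ⟨p, hp, ?_⟩
    intro X hX w hw
    have hcl : IsClosed {X : Fin n₁ → Fin n₂ → ℂ | MvPolynomial.eval (Gmap I k l X w) p = 0} := by
      refine isClosed_eq ?_ continuous_const
      refine (MvPolynomial.continuous_eval p).comp ?_
      refine continuous_pi fun e => ?_
      rcases e with ⟨i, a⟩ | ⟨i, j⟩ <;> simp only [Gmap] <;> split_ifs <;> fun_prop
    refine closure_minimal ?_ hcl hX
    intro X hX
    obtain ⟨c, t, hct⟩ := hS X hX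
    have hXe : X = fun a b => c * MvPolynomial.eval t (x a b) := by funext a b; exact hct a b
    obtain ⟨w', hw', hG⟩ := Gmap_scale I k l (fun a b => MvPolynomial.eval t (x a b)) c w hw
    show MvPolynomial.eval (Gmap I k l X w) p = 0
    rw [hXe, hG]
    let φ : MvPolynomial (σ ⊕ ρ) ℂ →+* ℂ := MvPolynomial.eval (Sum.elim t (fun e => w' e.1))
    have h3 := congrArg φ hpe
    rw [MvPolynomial.aeval_def, MvPolynomial.hom_eval₂, map_zero] at h3
    rw [← h3]
    show MvPolynomial.eval₂ _ _ p = _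
    congr 1
    · ext; simp [φ]
    · funext e
      show _ = φ _
      rw [Gmap_hom]
      congr 1
      · funext a b
        simp [φ, MvPolynomial.eval_rename, Function.comp_def]
      · funext e
        simp only [W]
        by_cases h : e ∈ Finset.univ.image (exc I k l)
        · rw [dif_neg (not_not.2 h), map_zero]
          simp only [Finset.mem_image, Finset.mem_univ, true_and] at h
          obtain ⟨i, rfl⟩ := h
          exact hw' i
        · rw [dif_pos h]; simp [φ]
  choose p hp h using key
  refine ⟨∏ q, p q, Finset.prod_ne_zero_iff.2 fun i _ => hp i, ?_⟩
  intro X hX hX0 Y Z hYZ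
  obtain ⟨k, l, hkl⟩ : ∃ k l, X k l ≠ 0 := by
    by_contra! hcon
    exact hX0 (by funext k l; exact hcon k l)
  obtain ⟨I, w, hw, hG⟩ := Gmap_surj X k l hkl Y Z hYZ
  rw [map_prod]
  refine Finset.prod_eq_zero (Finset.mem_univ (I, k, l)) ?_
  rw [← hG]
  exact h (I, k, l) X hX w hw

theorem Good.bilin {m n₁ n₂ : ℕ} (S S' : Finset (Fin n₁)) (T T' : Finset (Fin n₂))
    (b b' : Fin n₁ → ℂ) (d d' : Fin n₂ → ℂ) (h : S.card + T.card + (S'.card + T'.card) < m) :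
    Good m n₁ n₂ {X | ∃ (c : ℂ) (u : Fin n₁ → ℂ) (v : Fin n₂ → ℂ) (u' : Fin n₁ → ℂ)
      (v' : Fin n₂ → ℂ), (∀ i, i ∉ S → u i = b i) ∧ (∀ i, i ∉ T → v i = d i) ∧
      (∀ i, i ∉ S' → u' i = b' i) ∧ (∀ i, i ∉ T' → v' i = d' i) ∧
      ∀ i j, X i j = c * (u i * v j + u' i * v' j)} := by
  classical
  let σ := (S ⊕ T) ⊕ (S' ⊕ T')
  let xu : Fin n₁ → MvPolynomial σ ℂ := fun i =>
    if h : i ∈ S then MvPolynomial.X (Sum.inl (Sum.inl ⟨i, h⟩)) else MvPolynomial.C (b i)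
  let xv : Fin n₂ → MvPolynomial σ ℂ := fun i =>
    if h : i ∈ T then MvPolynomial.X (Sum.inl (Sum.inr ⟨i, h⟩)) else MvPolynomial.C (d i)
  let xu' : Fin n₁ → MvPolynomial σ ℂ := fun i =>
    if h : i ∈ S' then MvPolynomial.X (Sum.inr (Sum.inl ⟨i, h⟩)) else MvPolynomial.C (b' i)
  let xv' : Fin n₂ → MvPolynomial σ ℂ := fun i =>
    if h : i ∈ T' then MvPolynomial.X (Sum.inr (Sum.inr ⟨i, h⟩)) else MvPolynomial.C (d' i)
  refine Good.param (σ := σ) (by simpa [σ] using h) (fun i j => xu i * xv j + xu' i * xv' j) _ ?_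
  rintro X ⟨c, u, v, u', v', hu, hv, hu', hv', hX⟩
  refine ⟨c, Sum.elim (Sum.elim (fun i => u i) (fun i => v i))
    (Sum.elim (fun i => u' i) (fun i => v' i)), ?_⟩
  intro i j
  rw [hX, map_add, map_mul, map_mul]
  have e1 : ∀ t : σ → ℂ, MvPolynomial.eval t (xu i) =
      if h : i ∈ S then t (Sum.inl (Sum.inl ⟨i, h⟩)) else b i := by
    intro t; by_cases h : i ∈ S <;> simp [xu, h]
  have e2 : ∀ t : σ → ℂ, MvPolynomial.eval t (xv j) =
      if h : j ∈ T then t (Sum.inl (Sum.inr ⟨j, h⟩)) else d j := by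
    intro t; by_cases h : j ∈ T <;> simp [xv, h]
  have e3 : ∀ t : σ → ℂ, MvPolynomial.eval t (xu' i) =
      if h : i ∈ S' then t (Sum.inr (Sum.inl ⟨i, h⟩)) else b' i := by
    intro t; by_cases h : i ∈ S' <;> simp [xu', h]
  have e4 : ∀ t : σ → ℂ, MvPolynomial.eval t (xv' j) =
      if h : j ∈ T' then t (Sum.inr (Sum.inr ⟨j, h⟩)) else d' j := by
    intro t; by_cases h : j ∈ T' <;> simp [xv', h]
  rw [e1, e2, e3, e4]
  have f1 := hu i
  have f2 := hv j
  have f3 := hu' i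
  have f4 := hv' j
  congr 2
  · congr 1
    · by_cases h : i ∈ S <;> simp [h, f1]
    · by_cases h : j ∈ T <;> simp [h, f2]
  · congr 1
    · by_cases h : i ∈ S' <;> simp [h, f3]
    · by_cases h : j ∈ T' <;> simp [h, f4]

theorem sparse_supp {n s : ℕ} (hs : s ≤ n) (u : Fin n → ℂ) (hu : Sparse s u) :
    ∃ S : Finset (Fin n), S.card = s ∧ ∀ i, i ∉ S → u i = 0 := by
  classical
  let S₀ : Finset (Fin n) := Finset.univ.filter (fun i => u i ≠ 0)
  have h0 : S₀.card ≤ s := by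
    have : {i | u i ≠ 0}.ncard = S₀.card := by
      rw [← Set.ncard_coe_finset]; congr 1; ext; simp [S₀]
    unfold Sparse at hu
    omega
  obtain ⟨S, hS, hc⟩ := Finset.exists_superset_card_eq h0 (by simpa using hs)
  refine ⟨S, hc, fun i hi => ?_⟩
  by_contra hne
  exact hi (hS (by simp [S₀, hne]))

theorem Sparse.smul {n s : ℕ} {u : Fin n → ℂ} (hu : Sparse s u) (c : ℂ) :
    Sparse s (fun i => c * u i) := by
  refine le_trans (Set.ncard_le_ncard ?_ (Set.toFinite _)) hu
  intro i hi
  simp only [Set.mem_ofPred_eq, ne_eq, mul_eq_zero, not_or] at hi ⊢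
  exact hi.2

theorem Sparse.zero {n s : ℕ} : Sparse s (fun _ : Fin n => (0 : ℂ)) := by
  simp [Sparse]

theorem claim1 {n₁ n₂ s₁ s₂ : ℕ} (hs₁ : 1 ≤ s₁) (h₁ : s₁ ≤ n₁) (h₂ : s₂ ≤ n₂)
    (u : Fin n₁ → ℂ) (v : Fin n₂ → ℂ) (hu : Sparse s₁ u) (hv : Sparse s₂ v) :
    ∃ (S : Finset (Fin n₁)) (a : Fin n₁) (T : Finset (Fin n₂)) (u' : Fin n₁ → ℂ) (v' : Fin n₂ → ℂ),
      S.card = s₁ ∧ a ∈ S ∧ T.card = s₂ ∧ (∀ i, i ∉ S.erase a → u' i = Pi.single (M := fun _ => ℂ) a 1 i) ∧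
      (∀ j, j ∉ T → v' j = 0) ∧ ∀ i j, u i * v j = u' i * v' j := by
  classical
  obtain ⟨S, hS, hSu⟩ := sparse_supp h₁ u hu
  obtain ⟨T, hT, hTv⟩ := sparse_supp h₂ v hv
  by_cases h : ∃ a, u a ≠ 0
  · obtain ⟨a, ha⟩ := h
    have haS : a ∈ S := by by_contra hh; exact ha (hSu a hh)
    refine ⟨S, a, T, fun i => u i / u a, fun j => u a * v j, hS, haS, hT, ?_, ?_, ?_⟩
    · intro i hi
      by_cases hia : i = a
      · subst hia; simp [ha]
      · have : i ∉ S := fun h => hi (Finset.mem_erase.2 ⟨hia, h⟩)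
        simp [hia, hSu i this]
    · intro j hj; simp [hTv j hj]
    · intro i j; field_simp
  · push Not at h
    obtain ⟨a, haS⟩ : S.Nonempty := by rw [← Finset.card_pos]; omega
    exact ⟨S, a, T, Pi.single a 1, fun _ => 0, hS, haS, hT, fun i _ => rfl, fun _ _ => rfl,
      fun i j => by simp [h i]⟩

/-- differences of sparse rank one matrices, as functions -/
def Dset (n₁ n₂ s₁ s₂ : ℕ) : Set (Fin n₁ → Fin n₂ → ℂ) :=
  {X | ∃ u v u' v', Sparse s₁ u ∧ Sparse s₂ v ∧ Sparse s₁ u' ∧ Sparse s₂ v' ∧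
    ∀ i j, X i j = u i * v j - u' i * v' j}

theorem good_general {m n₁ n₂ s₁ s₂ : ℕ} (hs₁ : 1 ≤ s₁) (h₁ : s₁ ≤ n₁) (hs₂ : 1 ≤ s₂) (h₂ : s₂ ≤ n₂)
    (hm : 2 * (s₁ + s₂) - 2 ≤ m) : Good m n₁ n₂ (Dset n₁ n₂ s₁ s₂) := by
  classical
  let ι := (Finset (Fin n₁) × Fin n₁) × (Finset (Fin n₂) × Fin n₂) × (Finset (Fin n₁) × Fin n₁) ×
    Finset (Fin n₂)
  let cond : ι → Prop := fun α => α.1.1.card = s₁ ∧ α.1.2 ∈ α.1.1 ∧ α.2.1.1.card = s₂ ∧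
    α.2.1.2 ∈ α.2.1.1 ∧ α.2.2.1.1.card = s₁ ∧ α.2.2.1.2 ∈ α.2.2.1.1 ∧ α.2.2.2.card = s₂
  let Q : ι → Set (Fin n₁ → Fin n₂ → ℂ) := fun α =>
    {X | cond α ∧ X ∈ {X | ∃ (c : ℂ) (u : Fin n₁ → ℂ) (v : Fin n₂ → ℂ) (u' : Fin n₁ → ℂ)
      (v' : Fin n₂ → ℂ), (∀ i, i ∉ α.1.1.erase α.1.2 → u i = Pi.single (M := fun _ => ℂ) α.1.2 1 i) ∧
      (∀ i, i ∉ α.2.1.1.erase α.2.1.2 → v i = Pi.single (M := fun _ => ℂ) α.2.1.2 1 i) ∧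
      (∀ i, i ∉ α.2.2.1.1.erase α.2.2.1.2 → u' i = Pi.single (M := fun _ => ℂ) α.2.2.1.2 1 i) ∧
      (∀ i, i ∉ α.2.2.2 → v' i = (fun _ => (0 : ℂ)) i) ∧
      ∀ i j, X i j = c * (u i * v j + u' i * v' j)}}
  let Q' : Option ι → Set (Fin n₁ → Fin n₂ → ℂ) := fun o => o.elim {0} Q
  have hQ : ∀ o, Good m n₁ n₂ (Q' o) := by
    rintro (_ | α)
    · exact Good.zero _ _ _
    · by_cases hc : cond α
      · refine (Good.bilin (α.1.1.erase α.1.2) (α.2.2.1.1.erase α.2.2.1.2) (α.2.1.1.erase α.2.1.2)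
          α.2.2.2 _ _ _ _ ?_).mono (fun X hX => hX.2)
        obtain ⟨c1, c2, c3, c4, c5, c6, c7⟩ := hc
        rw [Finset.card_erase_of_mem c2, Finset.card_erase_of_mem c4, Finset.card_erase_of_mem c6]
        omega
      · exact (Good.zero _ _ _).mono (fun X hX => absurd hX.1 hc)
  refine (Good.iUnion hQ).mono ?_
  intro X hX
  rw [Set.mem_iUnion]
  by_cases hX0 : X = 0
  · exact ⟨none, hX0⟩
  obtain ⟨u, v, u', v', hu, hv, hu', hv', hXe, hne⟩ : ∃ u v u' v', Sparse s₁ u ∧ Sparse s₂ v ∧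
      Sparse s₁ u' ∧ Sparse s₂ v' ∧ (∀ i j, X i j = u i * v j + u' i * v' j) ∧
      ∃ i j, u i * v j ≠ 0 := by
    obtain ⟨u, v, u', v', hu, hv, hu', hv', hXe⟩ := hX
    by_cases h : ∃ i j, u i * v j ≠ 0
    · exact ⟨u, v, u', _, hu, hv, hu', hv'.smul (-1), fun i j => by rw [hXe]; ring, h⟩
    · push Not at h
      refine ⟨u', _, _, _, hu', hv'.smul (-1), Sparse.zero, Sparse.zero, fun i j => by rw [hXe, h]; ring, ?_⟩
      by_contra! hcon
      apply hX0
      funext i j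
      have := hcon i j
      rw [hXe, h]
      simp only [Pi.zero_apply]
      linear_combination this
  obtain ⟨S, a, T, w, z, hS, ha, hT, hw, hz, huv⟩ := claim1 hs₁ h₁ h₂ u v hu hv
  obtain ⟨S', a', T', w', z', hS', ha', hT', hw', hz', huv'⟩ := claim1 hs₁ h₁ h₂ u' v' hu' hv'
  obtain ⟨i₀, b, hb⟩ := hne
  rw [huv] at hb
  have hzb : z b ≠ 0 := right_ne_zero_of_mul hb
  have hbT : b ∈ T := by by_contra hh; exact hzb (hz b hh)
  refine ⟨some ((S, a), (T, b), (S', a'), T'), ⟨hS, ha, hT, hbT, hS', ha', hT'⟩,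
    z b, w, fun j => z j / z b, w', fun j => z' j / z b, hw, ?_, hw', ?_, ?_⟩
  · intro j hj
    by_cases hia : j = b
    · subst hia; simp [hzb]
    · have : j ∉ T := fun h => hj (Finset.mem_erase.2 ⟨hia, h⟩)
      simp [hia, hz j this]
  · intro j hj
    simp [hz' j hj]
  · intro i j
    rw [hXe, huv, huv']
    field_simp

theorem full_normal {n₁ n₂ : ℕ} (hn : 2 ≤ n₂) (u u' : Fin n₁ → ℂ) (v v' : Fin n₂ → ℂ)
    (hne : ∃ i j, u i * v j - u' i * v' j ≠ 0) :
    ∃ (j₁ j₂ : Fin n₂) (p p' : Fin n₁ → ℂ) (q q' : Fin n₂ → ℂ), j₁ ≠ j₂ ∧ q j₁ = 1 ∧ q j₂ = 0 ∧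
      q' j₁ = 0 ∧ q' j₂ = 1 ∧ ∀ i j, u i * v j - u' i * v' j = p i * q j + p' i * q' j := by
  classical
  by_cases h : ∃ j₁ j₂, v j₁ * v' j₂ - v j₂ * v' j₁ ≠ 0
  · obtain ⟨j₁, j₂, hD⟩ := h
    refine ⟨j₁, j₂, fun i => v j₁ * u i - v' j₁ * u' i, fun i => v j₂ * u i - v' j₂ * u' i,
      fun j => (v' j₂ * v j - v j₂ * v' j) / (v j₁ * v' j₂ - v j₂ * v' j₁),
      fun j => (v j₁ * v' j - v' j₁ * v j) / (v j₁ * v' j₂ - v j₂ * v' j₁), ?_, ?_, ?_, ?_, ?_, ?_⟩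
    · rintro rfl; apply hD; ring
    · rw [div_eq_one_iff_eq hD]; ring
    · rw [div_eq_zero_iff]; left; ring
    · rw [div_eq_zero_iff]; left; ring
    · rw [div_eq_one_iff_eq hD]; ring
    · intro i j
      rw [mul_div_assoc', mul_div_assoc', ← add_div, eq_div_iff hD]
      ring
  · push Not at h
    -- rank one
    obtain ⟨g, w, hg⟩ : ∃ (g : Fin n₂ → ℂ) (w : Fin n₁ → ℂ),
        ∀ i j, u i * v j - u' i * v' j = w i * g j := by
      by_cases hv : ∃ l, v l ≠ 0
      · obtain ⟨l, hl⟩ := hv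
        refine ⟨v, fun i => u i - u' i * (v' l / v l), fun i j => ?_⟩
        have := h l j
        field_simp
        linear_combination (-u' i) * this
      · push Not at hv
        exact ⟨v', fun i => - u' i, fun i j => by rw [hv]; ring⟩
    obtain ⟨i₀, j₁, hj⟩ := hne
    rw [hg] at hj
    have hgj : g j₁ ≠ 0 := right_ne_zero_of_mul hj
    have : Nontrivial (Fin n₂) := Fin.nontrivial_iff_two_le.2 hn
    obtain ⟨j₂, hj₂⟩ := exists_ne j₁
    refine ⟨j₁, j₂, fun i => w i * g j₁, fun i => w i * g j₂, 
      fun j => if j = j₂ then 0 else g j / g j₁, fun j => if j = j₂ then 1 else 0,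
      hj₂.symm, ?_, ?_, ?_, ?_, ?_⟩
    · simp [hj₂.symm, hgj]
    · simp
    · simp [hj₂.symm]
    · simp
    · intro i j
      rw [hg]
      by_cases hjj : j = j₂
      · simp [hjj]
      · simp [hjj]; field_simp

theorem good_full {m n₁ n₂ s₁ s₂ : ℕ} (hn₁ : 2 ≤ n₁) (hn₂ : 2 ≤ n₂)
    (hm : 2 * (n₁ + n₂) - 4 ≤ m) : Good m n₁ n₂ (Dset n₁ n₂ s₁ s₂) := by
  classical
  let ι := Fin n₂ × Fin n₂ × Fin n₁
  let Q : ι → Set (Fin n₁ → Fin n₂ → ℂ) := fun α =>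
    {X | α.1 ≠ α.2.1 ∧ X ∈ {X | ∃ (c : ℂ) (u : Fin n₁ → ℂ) (v : Fin n₂ → ℂ) (u' : Fin n₁ → ℂ)
      (v' : Fin n₂ → ℂ), (∀ i, i ∉ Finset.univ.erase α.2.2 → u i = (fun _ => (1 : ℂ)) i) ∧
      (∀ i, i ∉ (Finset.univ.erase α.1).erase α.2.1 → v i = Pi.single (M := fun _ => ℂ) α.1 1 i) ∧
      (∀ i, i ∉ Finset.univ → u' i = (fun _ => (0 : ℂ)) i) ∧
      (∀ i, i ∉ (Finset.univ.erase α.1).erase α.2.1 → v' i = Pi.single (M := fun _ => ℂ) α.2.1 1 i) ∧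
      ∀ i j, X i j = c * (u i * v j + u' i * v' j)}}
  let Q' : Option ι → Set (Fin n₁ → Fin n₂ → ℂ) := fun o => o.elim {0} Q
  have hQ : ∀ o, Good m n₁ n₂ (Q' o) := by
    rintro (_ | α)
    · exact Good.zero _ _ _
    · by_cases hc : α.1 ≠ α.2.1
      · refine (Good.bilin (Finset.univ.erase α.2.2) Finset.univ
          ((Finset.univ.erase α.1).erase α.2.1) ((Finset.univ.erase α.1).erase α.2.1) 
          _ _ _ _ ?_).mono (fun X hX => hX.2)
        rw [Finset.card_erase_of_mem (by simp), Finset.card_erase_of_mem (by simp [hc.symm]),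
          Finset.card_erase_of_mem (by simp)]
        simp only [Finset.card_univ, Fintype.card_fin]
        omega
      · exact (Good.zero _ _ _).mono (fun X hX => absurd hX.1 hc)
  refine (Good.iUnion hQ).mono ?_
  intro X hX
  rw [Set.mem_iUnion]
  by_cases hX0 : X = 0
  · exact ⟨none, hX0⟩
  obtain ⟨u, v, u', v', -, -, -, -, hXe⟩ := hX
  obtain ⟨j₁, j₂, p, p', q, q', hj, hq1, hq2, hq1', hq2', he⟩ := full_normal hn₂ u u' v v' (by
    by_contra! hcon
    exact hX0 (by funext i j; rw [hXe]; exact hcon i j))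
  have main : ∀ (j₁ j₂ : Fin n₂) (p p' : Fin n₁ → ℂ) (q q' : Fin n₂ → ℂ), j₁ ≠ j₂ → q j₁ = 1 →
      q j₂ = 0 → q' j₁ = 0 → q' j₂ = 1 → (∀ i j, X i j = p i * q j + p' i * q' j) →
      (∃ r, p r ≠ 0) → ∃ o, X ∈ Q' o := by
    rintro j₁ j₂ p p' q q' hj hq1 hq2 hq1' hq2' he ⟨r, hr⟩
    have hmem : ∀ j, j ∉ (Finset.univ.erase j₁).erase j₂ → j = j₁ ∨ j = j₂ := by
      intro j hj
      simp only [Finset.mem_erase, Finset.mem_univ, and_true] at hj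
      tauto
    refine ⟨some (j₁, j₂, r), hj, p r, fun i => p i / p r, q, fun i => p' i / p r, q', ?_, ?_, ?_, ?_, ?_⟩
    · intro i hi
      have : i = r := by simpa using hi
      subst this
      simp [hr]
    · intro j hjm
      rcases hmem j hjm with rfl | rfl
      · simp [hq1]
      · simp [hq2, hj.symm]
    · intro i hi; simp at hi
    · intro j hjm
      rcases hmem j hjm with rfl | rfl
      · simp [hq1', hj]
      · simp [hq2']
    · intro i j
      rw [he]; field_simp
  by_cases hp : ∃ r, p r ≠ 0
  · exact main j₁ j₂ p p' q q' hj hq1 hq2 hq1' hq2' (fun i j => by rw [hXe, he]) hp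
  · refine main j₂ j₁ p' p q' q hj.symm hq2' hq1' hq2 hq1 (fun i j => by rw [hXe, he]; ring) ?_
    by_contra! hcon
    push Not at hp
    exact hX0 (by funext i j; rw [hXe, he, hp, hcon]; simp)

theorem l2_smul {m : ℕ} (c : ℝ) (hc : 0 ≤ c) (v : Fin m → ℂ) : l2 (fun i => (c : ℂ) * v i) = c * l2 v := by
  unfold l2
  simp only [norm_mul, mul_pow, ← Finset.mul_sum, Complex.norm_real, Real.norm_eq_abs, sq_abs]
  rw [Real.sqrt_mul (sq_nonneg c), Real.sqrt_sq hc]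

theorem frob_smul {a b : ℕ} (c : ℝ) (hc : 0 ≤ c) (X : Fin a → Fin b → ℂ) :
    frob (fun i j => (c : ℂ) * X i j) = c * frob X := by
  unfold frob
  simp only [norm_mul, mul_pow, ← Finset.mul_sum, Complex.norm_real, Real.norm_eq_abs, sq_abs]
  rw [Real.sqrt_mul (sq_nonneg c), Real.sqrt_sq hc]

theorem MYZ_apply {n₁ n₂ m : ℕ} (Y : Fin m → Fin n₁ → ℂ) (Z : Fin m → Fin n₂ → ℂ)
    (X : Fin n₁ → Fin n₂ → ℂ) (i : Fin m) :
    MYZ Y Z X i = ∑ j, (∑ a, Y i a * X a j) * Z i j := by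
  have h : ∀ X' : Matrix (Fin n₁) (Fin n₂) ℂ, MYZ Y Z X' i = ∑ j, (∑ a, Y i a * X' a j) * Z i j := by
    intro X'
    unfold MYZ
    rw [Matrix.trace]
    refine Finset.sum_congr rfl fun j _ => ?_
    rw [Matrix.diag_apply, Matrix.mul_apply, Finset.sum_mul]
    refine Finset.sum_congr rfl fun a _ => ?_
    rw [Matrix.vecMulVec_apply]
    ring
  exact h X

theorem mem_diff {n₁ n₂ s₁ s₂ : ℕ} (X : Matrix (Fin n₁) (Fin n₂) ℂ) 
    (h : X ∈ diffSet (M1 n₁ n₂ s₁ s₂)) : (X : Fin n₁ → Fin n₂ → ℂ) ∈ Dset n₁ n₂ s₁ s₂ := by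
  obtain ⟨_, ⟨u, v, hu, hv, rfl⟩, _, ⟨u', v', hu', hv', rfl⟩, rfl⟩ := h
  exact ⟨u, v, u', v', hu, hv, hu', hv', fun i j => by
    rw [Matrix.sub_apply, Matrix.vecMulVec_apply, Matrix.vecMulVec_apply]⟩

theorem Dset_smul {n₁ n₂ s₁ s₂ : ℕ} {X : Fin n₁ → Fin n₂ → ℂ} (h : X ∈ Dset n₁ n₂ s₁ s₂) (c : ℂ) :
    (fun i j => c * X i j) ∈ Dset n₁ n₂ s₁ s₂ := by
  obtain ⟨u, v, u', v', hu, hv, hu', hv', hX⟩ := h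
  exact ⟨_, v, _, v', hu.smul c, hv, hu'.smul c, hv', fun i j => by simp only [hX]; ring⟩

theorem not_stable {n₁ n₂ s₁ s₂ m : ℕ} (Y : Fin m → Fin n₁ → ℂ) (Z : Fin m → Fin n₂ → ℂ)
    (h : ¬ StablyInj n₁ n₂ s₁ s₂ m (MYZ Y Z)) :
    ∃ X ∈ closure (Dset n₁ n₂ s₁ s₂), X ≠ 0 ∧ ∀ i, ∑ j, (∑ a, Y i a * X a j) * Z i j = 0 := by
  by_contra! hcon
  apply h
  let f : (Fin n₁ → Fin n₂ → ℂ) → ℝ := fun X => frob X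
  let g : (Fin n₁ → Fin n₂ → ℂ) → ℝ := fun X => l2 (MYZ Y Z X)
  have hf : Continuous f := by
    simp only [f, frob]; fun_prop
  have hg : Continuous g := by
    simp only [g, l2, MYZ_apply]; fun_prop
  let K := closure (Dset n₁ n₂ s₁ s₂) ∩ {X | f X = 1}
  have hK : IsCompact K := by
    refine Metric.isCompact_of_isClosed_isBounded
      (isClosed_closure.inter (isClosed_eq hf continuous_const)) ?_
    refine (Metric.isBounded_closedBall (x := 0) (r := 1)).subset ?_
    rintro X ⟨-, hX⟩
    rw [mem_closedBall_zero_iff, pi_norm_le_iff_of_nonneg zero_le_one]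
    intro i
    rw [pi_norm_le_iff_of_nonneg zero_le_one]
    intro j
    have h1 : ‖X i j‖ ^ 2 ≤ ∑ i, ∑ j, ‖X i j‖ ^ 2 :=
      le_trans (Finset.single_le_sum (f := fun j => ‖X i j‖ ^ 2) (fun _ _ => by positivity) (Finset.mem_univ j))
        (Finset.single_le_sum (f := fun i => ∑ j, ‖X i j‖ ^ 2) (fun _ _ => by positivity) (Finset.mem_univ i))
    have h2 : Real.sqrt (∑ i, ∑ j, ‖X i j‖ ^ 2) = 1 := hX
    rw [Real.sqrt_eq_one] at h2
    rw [h2] at h1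
    exact (sq_le_one_iff₀ (norm_nonneg _)).1 h1
  have hnorm : ∀ X ∈ Dset n₁ n₂ s₁ s₂, f X ≠ 0 → (fun i j => (((f X)⁻¹ : ℝ) : ℂ) * X i j) ∈ K := by
    intro X hX hfX
    refine ⟨subset_closure (Dset_smul hX _), ?_⟩
    show frob _ = 1
    have h0 : 0 ≤ f X := Real.sqrt_nonneg _
    rw [frob_smul _ (inv_nonneg.2 h0)]
    exact inv_mul_cancel₀ hfX
  have hscale : ∀ (X : Fin n₁ → Fin n₂ → ℂ) (c : ℝ), 0 ≤ c →
      g (fun i j => (c : ℂ) * X i j) = c * g X := by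
    intro X c hc
    simp only [g]
    rw [← l2_smul _ hc]
    congr 1
    funext i
    rw [MYZ_apply, MYZ_apply]
    simp only [Finset.mul_sum, Finset.sum_mul]
    refine Finset.sum_congr rfl fun j _ => Finset.sum_congr rfl fun a _ => ?_
    ring
  by_cases hne : K.Nonempty
  · obtain ⟨X₀, hX₀, hmin⟩ := hK.exists_isMinOn hne hg.continuousOn
    have hX₀0 : X₀ ≠ 0 := by
      rintro rfl
      have h2 : frob (0 : Matrix (Fin n₁) (Fin n₂) ℂ) = 1 := hX₀.2
      simp [frob] at h2
    obtain ⟨i, hi⟩ := hcon X₀ hX₀.1 hX₀0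
    refine ⟨g X₀, ?_, ?_⟩
    · refine Real.sqrt_pos.2 ?_
      refine lt_of_lt_of_le ?_ (Finset.single_le_sum (f := fun i => ‖MYZ Y Z X₀ i‖ ^ 2)
        (fun _ _ => by positivity) (Finset.mem_univ i))
      have : MYZ Y Z X₀ i ≠ 0 := by rw [MYZ_apply]; exact hi
      positivity
    · intro X hX
      have hX' := mem_diff X hX
      by_cases hfX : f X = 0
      · have : frob X = 0 := hfX
        rw [this, mul_zero]; exact Real.sqrt_nonneg _
      · have h0 : 0 ≤ f X := Real.sqrt_nonneg _
        have h3 := hmin (hnorm X hX' hfX)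
        have h4 := hscale X _ (inv_nonneg.2 h0)
        have h5 : g X₀ ≤ (f X)⁻¹ * g X := h4 ▸ h3
        show g X₀ * f X ≤ g X
        have hpos : 0 < f X := lt_of_le_of_ne h0 (Ne.symm hfX)
        rw [inv_mul_eq_div, le_div_iff₀ hpos] at h5
        exact h5
  · refine ⟨1, one_pos, fun X hX => ?_⟩
    have hX' := mem_diff X hX
    have : frob X = 0 := by
      by_contra hfX
      exact hne ⟨_, hnorm X hX' hfX⟩
    rw [this, mul_zero]; exact Real.sqrt_nonneg _

theorem stmt17 (n₁ n₂ s₁ s₂ m : ℕ) (hn₁ : 2 ≤ n₁) (hn₂ : 2 ≤ n₂)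
    (hs₁ : 1 ≤ s₁) (hs₁n : s₁ ≤ n₁) (hs₂ : 1 ≤ s₂) (hs₂n : s₂ ≤ n₂)
    (hm : if s₁ = n₁ ∧ s₂ = n₂ then 2 * (n₁ + n₂) - 4 ≤ m else 2 * (s₁ + s₂) - 2 ≤ m) :
    (@topologicalKrullDim
        ↥{YZ : (Fin m → Fin n₁ → ℂ) × (Fin m → Fin n₂ → ℂ) |
          ¬ StablyInj n₁ n₂ s₁ s₂ m (MYZ YZ.1 YZ.2)}
        (@instTopologicalSpaceSubtype _ _ (zarProd m n₁ n₂))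
        < ((m * (n₁ + n₂) : ℕ) : WithBot ℕ∞)) ∧
    volume {YZ : (Fin m → Fin n₁ → ℂ) × (Fin m → Fin n₂ → ℂ) |
      ¬ StablyInj n₁ n₂ s₁ s₂ m (MYZ YZ.1 YZ.2)} = 0 := by
  have hgood : Good m n₁ n₂ (Dset n₁ n₂ s₁ s₂) := by
    split_ifs at hm with h
    · exact good_full hn₁ hn₂ hm
    · exact good_general hs₁ hs₁n hs₂ hs₂n hm
  obtain ⟨p, hp, hkill⟩ := hgood
  let co : ((Fin m → Fin n₁ → ℂ) × (Fin m → Fin n₂ → ℂ)) →ₗ[ℝ] (Tau m n₁ n₂ → ℂ) :=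
    { toFun := fun YZ => Sum.elim (fun q => YZ.1 q.1 q.2) (fun q => YZ.2 q.1 q.2)
      map_add' := by intro x y; funext e; rcases e with e | e <;> rfl
      map_smul' := by intro c x; funext e; rcases e with e | e <;> rfl }
  have hB : ∀ YZ ∈ {YZ : (Fin m → Fin n₁ → ℂ) × (Fin m → Fin n₂ → ℂ) |
      ¬ StablyInj n₁ n₂ s₁ s₂ m (MYZ YZ.1 YZ.2)}, MvPolynomial.eval (co YZ) p = 0 := by
    intro YZ h
    obtain ⟨X, hX, hX0, hXZ⟩ := not_stable YZ.1 YZ.2 h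
    exact hkill X hX hX0 YZ.1 YZ.2 hXZ
  constructor
  · have := @krull_aux _ (Tau m n₁ n₂) _ (zarProd m n₁ n₂) co rfl _ p hp hB
    have hc : Fintype.card (Tau m n₁ n₂) = m * (n₁ + n₂) := by simp; ring
    rw [hc] at this
    exact this
  · have i1 : (volume : Measure (Fin m → Fin n₁ → ℂ)).IsAddHaarMeasure :=
      Measure.pi.isAddHaarMeasure _
    have i2 : (volume : Measure (Fin m → Fin n₂ → ℂ)).IsAddHaarMeasure :=
      Measure.pi.isAddHaarMeasure _
    have i3 : (volume : Measure ((Fin m → Fin n₁ → ℂ) × (Fin m → Fin n₂ → ℂ))).IsAddHaarMeasure :=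
      Measure.prod.instIsAddHaarMeasure _ _
    refine measure_mono_null hB (meas_poly volume co ?_ p hp)
    intro y
    refine ⟨(fun i a => y (Sum.inl (i, a)), fun i j => y (Sum.inr (i, j))), ?_⟩
    funext e
    rcases e with e | e <;> rfl
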